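/- (Fundamental inequality for the projected step) Assume c(x,y) ≥ 0 for all (x,y), let B, B̄ > 0 with λ(max{B,B̄}) := e^{2·max{B,B̄}} · E_{(x,y')∼μ⊗ν}[exp(c(x,y')/ε)] < ∞, and set S_B := { φ ∈ L²(ν) : ‖φ‖_{L^∞(𝒴)} ≤ B }. For η > 0 and φ ∈ S_{B̄}, let M(φ; η) be the minimizer over φ̄ ∈ S_B of ‖ φ̄ − (φ + η · δJ(φ)/ν) ‖²_{L²(ν)}. Then for every η ≤ λ(max{B,B̄})^{-1} and every φ̄ ∈ S_B, J(M(φ; η)) − J(φ̄) ≥ (1/(2η)) · ‖M(φ; η) − φ‖²_{L²(ν)} + (1/η) · ⟨ M(φ; η) − φ, φ − φ̄ ⟩_{L²(ν)}, where ⟨f,g⟩_{L²(ν)} := ∫_𝒴 f g dν. -/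

import Mathlib

open MeasureTheory

noncomputable section

variable {d : ℕ}

/-- `φ⁺(x) = log ∫ exp(φ(y) - c(x,y)/ε) dν(y)`, with `ν` the density of the marginal on `𝒴`. -/
def phiPlus (ν : (Fin d → ℝ) → ℝ) (c : (Fin d → ℝ) → (Fin d → ℝ) → ℝ) (ε : ℝ)
    (φ : (Fin d → ℝ) → ℝ) (x : Fin d → ℝ) : ℝ :=
  Real.log (∫ y, Real.exp (φ y - c x y / ε) * ν y)

/-- The semi-dual `J(φ) = ∫ φ dν - ∫ φ⁺ dμ`. -/
def semiDual (μ ν : (Fin d → ℝ) → ℝ) (c : (Fin d → ℝ) → (Fin d → ℝ) → ℝ) (ε : ℝ)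
    (φ : (Fin d → ℝ) → ℝ) : ℝ :=
  (∫ y, φ y * ν y) - ∫ x, phiPlus ν c ε φ x * μ x

/-- The joint density `π(φ, φ⁺)(x,y) = exp(φ(y) - φ⁺(x) - c(x,y)/ε) μ(x) ν(y)`. -/
def piJoint (μ ν : (Fin d → ℝ) → ℝ) (c : (Fin d → ℝ) → (Fin d → ℝ) → ℝ) (ε : ℝ)
    (φ : (Fin d → ℝ) → ℝ) (z : (Fin d → ℝ) × (Fin d → ℝ)) : ℝ :=
  Real.exp (φ z.2 - phiPlus ν c ε φ z.1 - c z.1 z.2 / ε) * μ z.1 * ν z.2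

/-- The `𝒴`-marginal density of `π(φ, φ⁺)`. -/
def piY (μ ν : (Fin d → ℝ) → ℝ) (c : (Fin d → ℝ) → (Fin d → ℝ) → ℝ) (ε : ℝ)
    (φ : (Fin d → ℝ) → ℝ) (y : Fin d → ℝ) : ℝ :=
  ∫ x, piJoint μ ν c ε φ (x, y)

/-- First variation of the semi-dual: `δJ(φ) = ν - π(φ,φ⁺)_𝒴`. -/
def deltaJ (μ ν : (Fin d → ℝ) → ℝ) (c : (Fin d → ℝ) → (Fin d → ℝ) → ℝ) (ε : ℝ)
    (φ : (Fin d → ℝ) → ℝ) (y : Fin d → ℝ) : ℝ :=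
  ν y - piY μ ν c ε φ y

/-- `λ(B) = e^{2B} · E_{(x,y')∼μ⊗ν}[exp(c(x,y')/ε)]`. -/
def lamB (μ ν : (Fin d → ℝ) → ℝ) (c : (Fin d → ℝ) → (Fin d → ℝ) → ℝ) (ε B : ℝ) : ℝ :=
  Real.exp (2 * B) *
    ∫ z : (Fin d → ℝ) × (Fin d → ℝ), Real.exp (c z.1 z.2 / ε) * μ z.1 * ν z.2

section PointwiseBounds

variable {Y : Type*} [MeasurableSpace Y] {n : Measure Y}

/-- A quadratic function that is minimal at the left endpoint has nonnegative slope there. -/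
lemma nonneg_of_forall_quadratic_nonneg {A Q : ℝ} (hQ : 0 ≤ Q)
    (h : ∀ t : ℝ, 0 < t → t ≤ 1 → 0 ≤ 2 * t * A + t ^ 2 * Q) : 0 ≤ A := by
  by_contra! hA
  have hQ1 : 0 < Q + 1 := by linarith
  set t := min 1 (-A / (Q + 1)) with ht
  have ht0 : 0 < t := lt_min one_pos (div_pos (by linarith) hQ1)
  have h1 := h t ht0 (min_le_left _ _)
  have h2 : t * (Q + 1) ≤ -A := (le_div_iff₀ hQ1).1 (min_le_right _ _)
  nlinarith

lemma integrable_of_measurable_of_ae_abs_le [IsFiniteMeasure n] {f : Y → ℝ} {C : ℝ}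
    (hf : Measurable f) (h : ∀ᵐ y ∂n, |f y| ≤ C) : Integrable f n :=
  Integrable.of_bound hf.aestronglyMeasurable C (by simpa using h)

lemma integrable_exp_sub_of_nonneg [IsFiniteMeasure n] {w ψ : Y → ℝ} {K : ℝ}
    (hw : Measurable w) (hw0 : ∀ y, 0 ≤ w y) (hψ : Measurable ψ) (hψK : ∀ᵐ y ∂n, |ψ y| ≤ K) :
    Integrable (fun y => Real.exp (ψ y - w y)) n := by
  refine integrable_of_measurable_of_ae_abs_le (C := Real.exp K) (by fun_prop) ?_
  filter_upwards [hψK] with y hy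
  rw [Real.abs_exp, Real.exp_le_exp]
  linarith [(abs_le.1 hy).2, hw0 y]

lemma integrable_exp_neg_of_nonneg [IsFiniteMeasure n] {w : Y → ℝ}
    (hw : Measurable w) (hw0 : ∀ y, 0 ≤ w y) :
    Integrable (fun y => Real.exp (-w y)) n := by
  simpa using integrable_exp_sub_of_nonneg (n := n) (ψ := 0) (K := 0) hw hw0 measurable_zero
    (by simp)

lemma integral_exp_neg_pos_of_nonneg [IsProbabilityMeasure n] {w : Y → ℝ}
    (hw : Measurable w) (hw0 : ∀ y, 0 ≤ w y) : 0 < ∫ y, Real.exp (-w y) ∂n :=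
  integral_exp_pos (integrable_exp_neg_of_nonneg hw hw0)

/-- Jensen's inequality for `t ↦ t⁻¹`. -/
lemma inv_integral_exp_neg_le [IsProbabilityMeasure n] {w : Y → ℝ}
    (hw : Measurable w) (hw0 : ∀ y, 0 ≤ w y) (hwi : Integrable (fun y => Real.exp (w y)) n) :
    (∫ y, Real.exp (-w y) ∂n)⁻¹ ≤ ∫ y, Real.exp (w y) ∂n := by
  have hI := integral_exp_neg_pos_of_nonneg (n := n) hw hw0
  have hi := integrable_exp_neg_of_nonneg (n := n) hw hw0
  set a := (∫ y, Real.exp (-w y) ∂n)⁻¹ with ha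
  have key : ∫ y, (2 * a - a ^ 2 * Real.exp (-w y)) ∂n ≤ ∫ y, Real.exp (w y) ∂n := by
    refine integral_mono ((integrable_const _).sub (hi.const_mul _)) hwi fun y => ?_
    have h1 : Real.exp (w y) * Real.exp (-w y) = 1 := by rw [← Real.exp_add]; simp
    have h2 : Real.exp (w y) - (2 * a - a ^ 2 * Real.exp (-w y))
        = Real.exp (w y) * (1 - a * Real.exp (-w y)) ^ 2 := by
      linear_combination (2 * a - a ^ 2 * Real.exp (-w y)) * h1
    have h3 := mul_nonneg (Real.exp_pos (w y)).le (sq_nonneg (1 - a * Real.exp (-w y)))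
    simp only
    linarith
  rw [integral_sub (integrable_const _) (hi.const_mul _), integral_const,
    integral_const_mul] at key
  have h4 : a ^ 2 * (∫ y, Real.exp (-w y) ∂n) = a := by
    rw [ha]; field_simp
  rw [h4, probReal_univ, one_smul] at key
  linarith

lemma integral_exp_sub_le [IsProbabilityMeasure n] {w ψ : Y → ℝ} {K : ℝ}
    (hw : Measurable w) (hw0 : ∀ y, 0 ≤ w y) (hψ : Measurable ψ) (hψK : ∀ᵐ y ∂n, |ψ y| ≤ K) :
    ∫ y, Real.exp (ψ y - w y) ∂n ≤ Real.exp K := by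
  calc _ ≤ ∫ _, Real.exp K ∂n := by
        refine integral_mono_ae (integrable_exp_sub_of_nonneg hw hw0 hψ hψK)
          (integrable_const _) ?_
        filter_upwards [hψK] with y hy
        simp only [Real.exp_le_exp]
        linarith [(abs_le.1 hy).2, hw0 y]
    _ = _ := by simp

lemma le_integral_exp_sub [IsProbabilityMeasure n] {w ψ : Y → ℝ} {K : ℝ}
    (hw : Measurable w) (hw0 : ∀ y, 0 ≤ w y) (hψ : Measurable ψ) (hψK : ∀ᵐ y ∂n, |ψ y| ≤ K) :
    Real.exp (-K) * ∫ y, Real.exp (-w y) ∂n ≤ ∫ y, Real.exp (ψ y - w y) ∂n := by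
  rw [← integral_const_mul]
  refine integral_mono_ae ((integrable_exp_neg_of_nonneg hw hw0).const_mul _)
    (integrable_exp_sub_of_nonneg hw hw0 hψ hψK) ?_
  filter_upwards [hψK] with y hy
  rw [← Real.exp_add, Real.exp_le_exp]
  linarith [(abs_le.1 hy).1]

lemma integral_exp_sub_pos [IsProbabilityMeasure n] {w ψ : Y → ℝ} {K : ℝ}
    (hw : Measurable w) (hw0 : ∀ y, 0 ≤ w y) (hψ : Measurable ψ) (hψK : ∀ᵐ y ∂n, |ψ y| ≤ K) :
    0 < ∫ y, Real.exp (ψ y - w y) ∂n :=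
  integral_exp_pos (integrable_exp_sub_of_nonneg hw hw0 hψ hψK)

lemma exp_neg_log_integral_exp_sub_le [IsProbabilityMeasure n] {w ψ : Y → ℝ} {K : ℝ}
    (hw : Measurable w) (hw0 : ∀ y, 0 ≤ w y) (hwi : Integrable (fun y => Real.exp (w y)) n)
    (hψ : Measurable ψ) (hψK : ∀ᵐ y ∂n, |ψ y| ≤ K) :
    Real.exp (-Real.log (∫ y, Real.exp (ψ y - w y) ∂n))
      ≤ Real.exp K * ∫ y, Real.exp (w y) ∂n := by
  rw [Real.exp_neg, Real.exp_log (integral_exp_sub_pos hw hw0 hψ hψK)]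
  have h := inv_anti₀ (mul_pos (Real.exp_pos (-K)) (integral_exp_neg_pos_of_nonneg hw hw0))
    (le_integral_exp_sub hw hw0 hψ hψK)
  refine h.trans ?_
  rw [mul_inv, Real.exp_neg, inv_inv]
  exact mul_le_mul_of_nonneg_left (inv_integral_exp_neg_le hw hw0 hwi) (Real.exp_pos _).le

lemma abs_log_integral_exp_sub_le [IsProbabilityMeasure n] {w ψ : Y → ℝ} {K : ℝ} (hK : 0 ≤ K)
    (hw : Measurable w) (hw0 : ∀ y, 0 ≤ w y) (hwi : Integrable (fun y => Real.exp (w y)) n)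
    (hψ : Measurable ψ) (hψK : ∀ᵐ y ∂n, |ψ y| ≤ K) :
    |Real.log (∫ y, Real.exp (ψ y - w y) ∂n)| ≤ K + Real.exp K * ∫ y, Real.exp (w y) ∂n := by
  have h0 : 0 ≤ Real.exp K * ∫ y, Real.exp (w y) ∂n :=
    mul_nonneg (Real.exp_pos _).le (integral_nonneg fun _ => (Real.exp_pos _).le)
  rw [abs_le]
  constructor
  · have h1 := exp_neg_log_integral_exp_sub_le hw hw0 hwi hψ hψK
    have h2 := Real.add_one_le_exp (-Real.log (∫ y, Real.exp (ψ y - w y) ∂n))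
    linarith
  · have h1 := (Real.log_le_iff_le_exp (integral_exp_sub_pos hw hw0 hψ hψK)).2
      (integral_exp_sub_le hw hw0 hψ hψK)
    linarith

/-- Second moments under a Gibbs measure are controlled by those under the reference measure. -/
lemma integral_sq_tilted_le [IsProbabilityMeasure n] {w ψ h : Y → ℝ} {K C : ℝ}
    (hw : Measurable w) (hw0 : ∀ y, 0 ≤ w y) (hwi : Integrable (fun y => Real.exp (w y)) n)
    (hψ : Measurable ψ) (hψK : ∀ᵐ y ∂n, |ψ y| ≤ K)
    (hh : Measurable h) (hhC : ∀ᵐ y ∂n, |h y| ≤ C) :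
    ∫ y, h y ^ 2 ∂(n.tilted fun y => ψ y - w y)
      ≤ Real.exp (2 * K) * (∫ y, Real.exp (w y) ∂n) * ∫ y, h y ^ 2 ∂n := by
  have hhi : Integrable (fun y => h y ^ 2) n := by
    refine integrable_of_measurable_of_ae_abs_le (C := C ^ 2) (by fun_prop) ?_
    filter_upwards [hhC] with y hy
    rw [abs_pow]
    gcongr
  have hZ := integral_exp_sub_pos hw hw0 hψ hψK
  have hle := exp_neg_log_integral_exp_sub_le hw hw0 hwi hψ hψK
  rw [Real.exp_neg, Real.exp_log hZ] at hle
  rw [integral_tilted, ← integral_const_mul]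
  refine integral_mono_of_nonneg (.of_forall fun y => ?_) (hhi.const_mul _) ?_
  · simp only [smul_eq_mul, Pi.zero_apply]
    exact mul_nonneg (div_nonneg (Real.exp_pos _).le hZ.le) (sq_nonneg _)
  · filter_upwards [hψK] with y hy
    rw [smul_eq_mul]
    refine mul_le_mul_of_nonneg_right ?_ (sq_nonneg _)
    rw [div_eq_mul_inv, two_mul, Real.exp_add, mul_assoc]
    refine mul_le_mul ?_ hle (inv_nonneg.2 hZ.le) (Real.exp_pos _).le
    rw [Real.exp_le_exp]
    linarith [(abs_le.1 hy).2, hw0 y]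

lemma cgf_one_le_integral_add [IsProbabilityMeasure n] {h : Y → ℝ} {C V : ℝ}
    (hh : Measurable h) (hhC : ∀ᵐ y ∂n, |h y| ≤ C)
    (hV : ∀ u ∈ Set.Ioo (0 : ℝ) 1, ∫ y, h y ^ 2 ∂(n.tilted fun y => u * h y) ≤ V) :
    Real.log (∫ y, Real.exp (h y) ∂n) ≤ (∫ y, h y ∂n) + V / 2 := by
  set k := ∫ y, h y ∂n with hk
  have hi : ∀ t : ℝ, ∀ b : ℝ, Integrable (fun y => Real.exp (t * (h y - b))) n := fun t b => by
    refine integrable_of_measurable_of_ae_abs_le (C := Real.exp (|t| * (C + |b|)))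
      (by fun_prop) ?_
    filter_upwards [hhC] with y hy
    rw [Real.abs_exp, Real.exp_le_exp]
    refine (le_abs_self _).trans ?_
    rw [abs_mul]
    gcongr
    exact (abs_sub _ _).trans (by gcongr)
  have hhi := integrable_of_measurable_of_ae_abs_le hh hhC
  have hs : ∀ s : Set ℝ, s ⊆ interior (ProbabilityTheory.integrableExpSet (fun y => h y - k) n) := by
    have : ProbabilityTheory.integrableExpSet (fun y => h y - k) n = Set.univ := by
      ext t; simpa [ProbabilityTheory.integrableExpSet] using hi t k
    simp [this]
  obtain ⟨u, hu, hcgf⟩ := ProbabilityTheory.exists_cgf_eq_iteratedDeriv_two_cgf_mul (μ := n)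
    (X := fun y => h y - k) one_pos
    (by rw [integral_sub hhi (integrable_const _)]; simp [hk]) (hs _)
  rw [← ProbabilityTheory.variance_tilted_mul (hs Set.univ (Set.mem_univ u))] at hcgf
  have hP : IsProbabilityMeasure (n.tilted fun y => u * (h y - k)) :=
    isProbabilityMeasure_tilted (hi u k)
  have htilt : (n.tilted fun y => u * (h y - k)) = n.tilted fun y => u * h y := by
    have hi0 : Integrable (fun y => Real.exp (u * h y)) n := by simpa using hi u 0
    have := isProbabilityMeasure_tilted hi0
    rw [← tilted_const (n.tilted fun y => u * h y) (-(u * k)), tilted_tilted hi0]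
    congr 1
    funext y
    simp only [Pi.add_apply]
    ring
  have hvar : ProbabilityTheory.variance (fun y => h y - k) (n.tilted fun y => u * (h y - k)) ≤ V := by
    rw [ProbabilityTheory.variance_sub_const hh.aestronglyMeasurable]
    refine (ProbabilityTheory.variance_le_expectation_sq hh.aestronglyMeasurable).trans ?_
    rw [htilt]
    exact hV u hu
  have hlog : ProbabilityTheory.cgf (fun y => h y - k) n 1
      = Real.log (∫ y, Real.exp (h y) ∂n) - k := by
    have hpos : 0 < ∫ y, Real.exp (h y) ∂n := integral_exp_pos (by simpa using hi 1 0)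
    simp only [ProbabilityTheory.cgf, ProbabilityTheory.mgf, one_mul, Real.exp_sub]
    rw [integral_div, Real.log_div hpos.ne' (Real.exp_pos _).ne', Real.log_exp]
  rw [hlog] at hcgf
  linarith

/-- Smoothness of the log-partition function along bounded perturbations. -/
lemma log_integral_exp_sub_le_add [IsProbabilityMeasure n] {w φ ψ : Y → ℝ} {K : ℝ}
    (hw : Measurable w) (hw0 : ∀ y, 0 ≤ w y) (hwi : Integrable (fun y => Real.exp (w y)) n)
    (hφ : Measurable φ) (hφK : ∀ᵐ y ∂n, |φ y| ≤ K)
    (hψ : Measurable ψ) (hψK : ∀ᵐ y ∂n, |ψ y| ≤ K) :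
    Real.log (∫ y, Real.exp (ψ y - w y) ∂n) ≤ Real.log (∫ y, Real.exp (φ y - w y) ∂n)
      + (∫ y, (ψ y - φ y) * Real.exp (φ y - Real.log (∫ y, Real.exp (φ y - w y) ∂n) - w y) ∂n)
      + Real.exp (2 * K) * (∫ y, Real.exp (w y) ∂n) * (∫ y, (ψ y - φ y) ^ 2 ∂n) / 2 := by
  have hei := integrable_exp_sub_of_nonneg hw hw0 hφ hφK
  have hZ := integral_exp_sub_pos hw hw0 hφ hφK
  have hZψ := integral_exp_sub_pos hw hw0 hψ hψK
  have hP := isProbabilityMeasure_tilted hei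
  have hac := tilted_absolutelyContinuous n fun y => φ y - w y
  have hdiff : ∀ᵐ y ∂n, |ψ y - φ y| ≤ K + K := by
    filter_upwards [hφK, hψK] with y h1 h2
    exact (abs_sub _ _).trans (by gcongr)
  have key := cgf_one_le_integral_add (n := n.tilted fun y => φ y - w y)
    (h := fun y => ψ y - φ y) (C := K + K)
    (V := Real.exp (2 * K) * (∫ y, Real.exp (w y) ∂n) * (∫ y, (ψ y - φ y) ^ 2 ∂n))
    (by fun_prop) (hac.ae_le hdiff) (fun u hu => by
      rw [tilted_tilted hei]
      have heq : ((fun y => φ y - w y) + fun y => u * (ψ y - φ y))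
          = fun y => ((1 - u) * φ y + u * ψ y) - w y := by
        funext y; simp only [Pi.add_apply]; ring
      rw [heq]
      refine integral_sq_tilted_le hw hw0 hwi (by fun_prop) ?_ (by fun_prop) hdiff
      filter_upwards [hφK, hψK] with y h1 h2
      rw [abs_le] at h1 h2 ⊢
      constructor <;> nlinarith [hu.1, hu.2])
  have h1 : ∫ y, Real.exp (ψ y - φ y) ∂(n.tilted fun y => φ y - w y)
      = (∫ y, Real.exp (ψ y - w y) ∂n) / ∫ y, Real.exp (φ y - w y) ∂n := by
    rw [integral_exp_tilted]
    congr 2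
    funext y
    simp
  have h2 : ∫ y, (ψ y - φ y) ∂(n.tilted fun y => φ y - w y)
      = ∫ y, (ψ y - φ y) * Real.exp (φ y - Real.log (∫ y, Real.exp (φ y - w y) ∂n) - w y) ∂n := by
    rw [integral_tilted]
    congr 1
    funext y
    rw [sub_right_comm, Real.exp_sub _ (Real.log _), Real.exp_log hZ, smul_eq_mul, mul_comm]
  rw [h1, h2, Real.log_div hZψ.ne' hZ.ne'] at key
  linarith

/-- Convexity of the log-partition function. -/
lemma add_le_log_integral_exp_sub [IsProbabilityMeasure n] {w φ ψ : Y → ℝ} {K : ℝ}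
    (hw : Measurable w) (hw0 : ∀ y, 0 ≤ w y)
    (hφ : Measurable φ) (hφK : ∀ᵐ y ∂n, |φ y| ≤ K)
    (hψ : Measurable ψ) (hψK : ∀ᵐ y ∂n, |ψ y| ≤ K) :
    Real.log (∫ y, Real.exp (φ y - w y) ∂n)
      + (∫ y, (ψ y - φ y) * Real.exp (φ y - Real.log (∫ y, Real.exp (φ y - w y) ∂n) - w y) ∂n)
      ≤ Real.log (∫ y, Real.exp (ψ y - w y) ∂n) := by
  have hei := integrable_exp_sub_of_nonneg hw hw0 hφ hφK
  have heψ := integrable_exp_sub_of_nonneg hw hw0 hψ hψK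
  have hZ := integral_exp_sub_pos hw hw0 hφ hφK
  have hZψ := integral_exp_sub_pos hw hw0 hψ hψK
  set Z := ∫ y, Real.exp (φ y - w y) ∂n with hZdef
  set F := Real.log Z with hF
  set e := fun y => Real.exp (φ y - F - w y) with he
  have hee : e = fun y => Real.exp (φ y - w y) / Z := by
    funext y
    rw [he]
    simp only
    rw [sub_right_comm, Real.exp_sub _ F, hF, Real.exp_log hZ]
  have he1 : ∫ y, e y ∂n = 1 := by
    rw [hee, integral_div, div_self hZ.ne']
  have hei' : Integrable e n := by rw [hee]; exact hei.div_const _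
  have hdi : Integrable (fun y => (ψ y - φ y) * e y) n := by
    refine hei'.bdd_mul (c := K + K) (by fun_prop) ?_
    filter_upwards [hφK, hψK] with y h1 h2
    exact (abs_sub _ _).trans (by gcongr)
  set k := ∫ y, (ψ y - φ y) * e y ∂n with hk
  rw [Real.le_log_iff_exp_le hZψ]
  have hint : ∫ y, Real.exp (F + k) * ((1 - k) * e y + (ψ y - φ y) * e y) ∂n
      = Real.exp (F + k) := by
    rw [integral_const_mul, integral_add (hei'.const_mul _) hdi, integral_const_mul, he1, ← hk]
    ring
  rw [← hint]
  refine integral_mono (((hei'.const_mul _).add hdi).const_mul _) heψ fun y => ?_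
  have h1 := Real.add_one_le_exp (ψ y - φ y - k)
  have h2 : Real.exp (ψ y - w y) = Real.exp (F + k) * (Real.exp (ψ y - φ y - k) * e y) := by
    rw [he]; simp only [← Real.exp_add]; congr 1; ring
  simp only
  rw [h2]
  have h3 : 0 < e y := Real.exp_pos _
  refine mul_le_mul_of_nonneg_left ?_ (Real.exp_pos _).le
  nlinarith

end PointwiseBounds

section SemiDual

variable {X Y : Type*} [MeasurableSpace X] [MeasurableSpace Y] {m : Measure X} {n : Measure Y}

lemma measurable_log_integral_exp_sub [SFinite n] {a : X → Y → ℝ}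
    (ha : Measurable (Function.uncurry a)) {ψ : Y → ℝ} (hψ : Measurable ψ) :
    Measurable fun x => Real.log (∫ y, Real.exp (ψ y - a x y) ∂n) := by
  refine Real.measurable_log.comp ?_
  have h : Measurable fun z : X × Y => Real.exp (ψ z.2 - a z.1 z.2) :=
    Real.measurable_exp.comp ((hψ.comp measurable_snd).sub ha)
  exact h.stronglyMeasurable.integral_prod_right'.measurable

lemma integrable_log_integral_exp_sub [IsProbabilityMeasure m] [IsProbabilityMeasure n]
    {a : X → Y → ℝ} (ha : Measurable (Function.uncurry a)) (ha0 : ∀ x y, 0 ≤ a x y)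
    (hai : Integrable (fun z : X × Y => Real.exp (a z.1 z.2)) (m.prod n))
    {ψ : Y → ℝ} {K : ℝ} (hK : 0 ≤ K) (hψ : Measurable ψ) (hψK : ∀ᵐ y ∂n, |ψ y| ≤ K) :
    Integrable (fun x => Real.log (∫ y, Real.exp (ψ y - a x y) ∂n)) m := by
  refine Integrable.mono' ((integrable_const K).add (hai.integral_prod_left.const_mul (Real.exp K)))
    (measurable_log_integral_exp_sub ha hψ).aestronglyMeasurable ?_
  filter_upwards [hai.prod_right_ae] with x hx
  exact abs_log_integral_exp_sub_le hK ha.of_uncurry_left (ha0 x) hx hψ hψK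

lemma measurable_gibbs [SFinite n] {a : X → Y → ℝ}
    (ha : Measurable (Function.uncurry a)) {φ : Y → ℝ} (hφ : Measurable φ) :
    Measurable fun z : X × Y => Real.exp
      (φ z.2 - Real.log (∫ y, Real.exp (φ y - a z.1 y) ∂n) - a z.1 z.2) :=
  Real.measurable_exp.comp (((hφ.comp measurable_snd).sub
    ((measurable_log_integral_exp_sub ha hφ).comp measurable_fst)).sub ha)

/-- The Gibbs density is dominated by a function of the first variable alone. -/
lemma gibbs_le [IsProbabilityMeasure n]
    {a : X → Y → ℝ} (ha : Measurable (Function.uncurry a)) (ha0 : ∀ x y, 0 ≤ a x y)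
    {φ : Y → ℝ} {K : ℝ} (hφ : Measurable φ) (hφK : ∀ᵐ y ∂n, |φ y| ≤ K)
    {x : X} (hx : Integrable (fun y => Real.exp (a x y)) n) {y : Y} (hy : |φ y| ≤ K) :
    Real.exp (φ y - Real.log (∫ y, Real.exp (φ y - a x y) ∂n) - a x y)
      ≤ Real.exp (2 * K) * ∫ y, Real.exp (a x y) ∂n := by
  have h := exp_neg_log_integral_exp_sub_le ha.of_uncurry_left (ha0 x) hx hφ hφK
  calc _ ≤ Real.exp (K + -Real.log (∫ y, Real.exp (φ y - a x y) ∂n)) := by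
        rw [Real.exp_le_exp]
        linarith [(abs_le.1 hy).2, ha0 x y]
    _ ≤ Real.exp K * (Real.exp K * ∫ y, Real.exp (a x y) ∂n) := by
        rw [Real.exp_add]
        gcongr
    _ = _ := by rw [two_mul, Real.exp_add, mul_assoc]

lemma integrable_mul_gibbs [IsProbabilityMeasure m] [IsProbabilityMeasure n]
    {a : X → Y → ℝ} (ha : Measurable (Function.uncurry a)) (ha0 : ∀ x y, 0 ≤ a x y)
    (hai : Integrable (fun z : X × Y => Real.exp (a z.1 z.2)) (m.prod n))
    {φ h : Y → ℝ} {K C : ℝ} (hφ : Measurable φ) (hφK : ∀ᵐ y ∂n, |φ y| ≤ K)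
    (hh : Measurable h) (hhC : ∀ᵐ y ∂n, |h y| ≤ C) :
    Integrable (fun z : X × Y => h z.2 * Real.exp
      (φ z.2 - Real.log (∫ y, Real.exp (φ y - a z.1 y) ∂n) - a z.1 z.2)) (m.prod n) := by
  have hg : Integrable (fun z : X × Y => Real.exp
      (φ z.2 - Real.log (∫ y, Real.exp (φ y - a z.1 y) ∂n) - a z.1 z.2)) (m.prod n) := by
    refine Integrable.mono' ((hai.integral_prod_left.comp_fst n).const_mul (Real.exp (2 * K)))
      (measurable_gibbs ha hφ).aestronglyMeasurable ?_
    filter_upwards [Measure.quasiMeasurePreserving_fst.ae hai.prod_right_ae,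
      Measure.quasiMeasurePreserving_snd.ae hφK] with z hz1 hz2
    rw [Real.norm_eq_abs, Real.abs_exp]
    exact gibbs_le ha ha0 hφ hφK hz1 hz2
  refine hg.bdd_mul (c := C) (hh.comp measurable_snd).aestronglyMeasurable ?_
  filter_upwards [Measure.quasiMeasurePreserving_snd.ae hhC] with z hz
  exact hz

lemma integral_integral_mul_gibbs [IsProbabilityMeasure m] [IsProbabilityMeasure n]
    {a : X → Y → ℝ} (ha : Measurable (Function.uncurry a)) (ha0 : ∀ x y, 0 ≤ a x y)
    (hai : Integrable (fun z : X × Y => Real.exp (a z.1 z.2)) (m.prod n))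
    {φ h : Y → ℝ} {K C : ℝ} (hφ : Measurable φ) (hφK : ∀ᵐ y ∂n, |φ y| ≤ K)
    (hh : Measurable h) (hhC : ∀ᵐ y ∂n, |h y| ≤ C) :
    ∫ x, ∫ y, h y * Real.exp
        (φ y - Real.log (∫ y, Real.exp (φ y - a x y) ∂n) - a x y) ∂n ∂m
      = ∫ y, h y * ∫ x, Real.exp
        (φ y - Real.log (∫ y, Real.exp (φ y - a x y) ∂n) - a x y) ∂m ∂n := by
  rw [integral_integral_swap (integrable_mul_gibbs ha ha0 hai hφ hφK hh hhC)]
  simp only [integral_const_mul]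

lemma measurable_gibbs_marginal [SFinite m] [SFinite n] {a : X → Y → ℝ}
    (ha : Measurable (Function.uncurry a)) {φ : Y → ℝ} (hφ : Measurable φ) :
    Measurable fun y => ∫ x, Real.exp
      (φ y - Real.log (∫ y, Real.exp (φ y - a x y) ∂n) - a x y) ∂m :=
  (measurable_gibbs ha hφ).stronglyMeasurable.integral_prod_left'.measurable

lemma abs_gibbs_marginal_le [IsProbabilityMeasure m] [IsProbabilityMeasure n]
    {a : X → Y → ℝ} (ha : Measurable (Function.uncurry a)) (ha0 : ∀ x y, 0 ≤ a x y)
    (hai : Integrable (fun z : X × Y => Real.exp (a z.1 z.2)) (m.prod n))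
    {φ : Y → ℝ} {K : ℝ} (hφ : Measurable φ) (hφK : ∀ᵐ y ∂n, |φ y| ≤ K) :
    ∀ᵐ y ∂n, |∫ x, Real.exp
      (φ y - Real.log (∫ y, Real.exp (φ y - a x y) ∂n) - a x y) ∂m|
        ≤ ∫ x, Real.exp (2 * K) * ∫ y, Real.exp (a x y) ∂n ∂m := by
  filter_upwards [hφK] with y hy
  rw [abs_of_nonneg (integral_nonneg fun _ => (Real.exp_pos _).le)]
  refine integral_mono_of_nonneg (.of_forall fun _ => (Real.exp_pos _).le)
    (hai.integral_prod_left.const_mul _) ?_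
  filter_upwards [hai.prod_right_ae] with x hx
  exact gibbs_le ha ha0 hφ hφK hx hy

lemma integral_log_integral_exp_sub_le_add [IsProbabilityMeasure m] [IsProbabilityMeasure n]
    {a : X → Y → ℝ} (ha : Measurable (Function.uncurry a)) (ha0 : ∀ x y, 0 ≤ a x y)
    (hai : Integrable (fun z : X × Y => Real.exp (a z.1 z.2)) (m.prod n))
    {φ ψ : Y → ℝ} {K : ℝ} (hK : 0 ≤ K) (hφ : Measurable φ) (hφK : ∀ᵐ y ∂n, |φ y| ≤ K)
    (hψ : Measurable ψ) (hψK : ∀ᵐ y ∂n, |ψ y| ≤ K) :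
    ∫ x, Real.log (∫ y, Real.exp (ψ y - a x y) ∂n) ∂m
      ≤ (∫ x, Real.log (∫ y, Real.exp (φ y - a x y) ∂n) ∂m)
        + (∫ y, (ψ y - φ y) * ∫ x, Real.exp
            (φ y - Real.log (∫ y, Real.exp (φ y - a x y) ∂n) - a x y) ∂m ∂n)
        + Real.exp (2 * K) * (∫ z : X × Y, Real.exp (a z.1 z.2) ∂(m.prod n))
          * (∫ y, (ψ y - φ y) ^ 2 ∂n) / 2 := by
  have hdiff : ∀ᵐ y ∂n, |ψ y - φ y| ≤ K + K := by
    filter_upwards [hφK, hψK] with y h1 h2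
    exact (abs_sub _ _).trans (by gcongr)
  have hsub : Measurable fun y => ψ y - φ y := hψ.sub hφ
  have hF := integrable_log_integral_exp_sub ha ha0 hai hK hφ hφK
  have hD := (integrable_mul_gibbs ha ha0 hai hφ hφK hsub hdiff).integral_prod_left
  have hG := ((hai.integral_prod_left.const_mul (Real.exp (2 * K))).mul_const
    (∫ y, (ψ y - φ y) ^ 2 ∂n)).div_const 2
  rw [← integral_integral_mul_gibbs ha ha0 hai hφ hφK hsub hdiff, integral_prod _ hai,
    ← integral_const_mul (Real.exp (2 * K)) fun x => ∫ y, Real.exp (a x y) ∂n,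
    ← integral_mul_const, ← integral_div, ← integral_add hF hD,
    ← integral_add (by exact hF.add hD) hG]
  refine integral_mono_ae (integrable_log_integral_exp_sub ha ha0 hai hK hψ hψK)
    ((hF.add hD).add hG) ?_
  filter_upwards [hai.prod_right_ae] with x hx
  exact log_integral_exp_sub_le_add ha.of_uncurry_left (ha0 x) hx hφ hφK hψ hψK

lemma add_le_integral_log_integral_exp_sub [IsProbabilityMeasure m] [IsProbabilityMeasure n]
    {a : X → Y → ℝ} (ha : Measurable (Function.uncurry a)) (ha0 : ∀ x y, 0 ≤ a x y)
    (hai : Integrable (fun z : X × Y => Real.exp (a z.1 z.2)) (m.prod n))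
    {φ ψ : Y → ℝ} {K : ℝ} (hK : 0 ≤ K) (hφ : Measurable φ) (hφK : ∀ᵐ y ∂n, |φ y| ≤ K)
    (hψ : Measurable ψ) (hψK : ∀ᵐ y ∂n, |ψ y| ≤ K) :
    (∫ x, Real.log (∫ y, Real.exp (φ y - a x y) ∂n) ∂m)
        + (∫ y, (ψ y - φ y) * ∫ x, Real.exp
            (φ y - Real.log (∫ y, Real.exp (φ y - a x y) ∂n) - a x y) ∂m ∂n)
      ≤ ∫ x, Real.log (∫ y, Real.exp (ψ y - a x y) ∂n) ∂m := by
  have hdiff : ∀ᵐ y ∂n, |ψ y - φ y| ≤ K + K := by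
    filter_upwards [hφK, hψK] with y h1 h2
    exact (abs_sub _ _).trans (by gcongr)
  have hsub : Measurable fun y => ψ y - φ y := hψ.sub hφ
  have hF := integrable_log_integral_exp_sub ha ha0 hai hK hφ hφK
  have hD := (integrable_mul_gibbs ha ha0 hai hφ hφK hsub hdiff).integral_prod_left
  rw [← integral_integral_mul_gibbs ha ha0 hai hφ hφK hsub hdiff, ← integral_add hF hD]
  refine integral_mono (hF.add hD) (integrable_log_integral_exp_sub ha ha0 hai hK hψ hψK)
    fun x => ?_
  exact add_le_log_integral_exp_sub ha.of_uncurry_left (ha0 x) hφ hφK hψ hψK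

/-- Variational inequality for the projection onto a sup-norm ball in `L²`. -/
lemma integral_mul_nonneg_of_projection [IsProbabilityMeasure n] {f p q : Y → ℝ} {C : ℝ}
    (hf : Measurable f) (hfC : ∀ᵐ y ∂n, |f y| ≤ C) (hp : Measurable p)
    (hpC : ∀ᵐ y ∂n, |p y| ≤ C) (hq : Measurable q) (hqC : ∀ᵐ y ∂n, |q y| ≤ C)
    (hmin : ∀ t : ℝ, 0 < t → t ≤ 1 →
      ∫ y, (p y - f y) ^ 2 ∂n ≤ ∫ y, (p y + t * (q y - p y) - f y) ^ 2 ∂n) :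
    0 ≤ ∫ y, (p y - f y) * (q y - p y) ∂n := by
  have hb : ∀ u v s r : Y → ℝ, Measurable u → Measurable v → Measurable s → Measurable r →
      (∀ᵐ y ∂n, |u y| ≤ C) → (∀ᵐ y ∂n, |v y| ≤ C) → (∀ᵐ y ∂n, |s y| ≤ C) →
      (∀ᵐ y ∂n, |r y| ≤ C) → Integrable (fun y => (u y - v y) * (s y - r y)) n := by
    intro u v s r hu hv hs hr huC hvC hsC hrC
    refine integrable_of_measurable_of_ae_abs_le (C := (C + C) * (C + C)) (by fun_prop) ?_
    filter_upwards [huC, hvC, hsC, hrC] with y h1 h2 h3 h4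
    rw [abs_mul]
    have := (abs_nonneg _).trans h1
    exact mul_le_mul ((abs_sub _ _).trans (by gcongr)) ((abs_sub _ _).trans (by gcongr))
      (abs_nonneg _) (by positivity)
  have h1 := hb p f p f hp hf hp hf hpC hfC hpC hfC
  have h2 := hb p f q p hp hf hq hp hpC hfC hqC hpC
  have h3 := hb q p q p hq hp hq hp hqC hpC hqC hpC
  refine nonneg_of_forall_quadratic_nonneg (Q := ∫ y, (q y - p y) * (q y - p y) ∂n)
    (integral_nonneg fun _ => mul_self_nonneg _) fun t ht ht1 => ?_
  have h := hmin t ht ht1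
  have e1 : ∀ y, (p y - f y) ^ 2 = (p y - f y) * (p y - f y) := fun y => sq _
  have e2 : ∀ y, (p y + t * (q y - p y) - f y) ^ 2 = (p y - f y) * (p y - f y)
      + (2 * t * ((p y - f y) * (q y - p y)) + t ^ 2 * ((q y - p y) * (q y - p y))) :=
    fun y => by ring
  simp only [e1, e2] at h
  rw [integral_add h1 (by exact (h2.const_mul _).add (h3.const_mul _)),
    integral_add (h2.const_mul _) (h3.const_mul _), integral_const_mul, integral_const_mul] at h
  linarith

/-- One step of projected gradient ascent on the entropic semi-dual functional. -/
lemma semidual_projected_step [IsProbabilityMeasure m] [IsProbabilityMeasure n]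
    {a : X → Y → ℝ} (ha : Measurable (Function.uncurry a)) (ha0 : ∀ x y, 0 ≤ a x y)
    (hai : Integrable (fun z : X × Y => Real.exp (a z.1 z.2)) (m.prod n))
    {φ p q : Y → ℝ} {K η : ℝ} (hK : 0 ≤ K) (hη : 0 < η)
    (hηle : η ≤ (Real.exp (2 * K) * ∫ z : X × Y, Real.exp (a z.1 z.2) ∂(m.prod n))⁻¹)
    (hφ : Measurable φ) (hφK : ∀ᵐ y ∂n, |φ y| ≤ K)
    (hp : Measurable p) (hpK : ∀ᵐ y ∂n, |p y| ≤ K)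
    (hq : Measurable q) (hqK : ∀ᵐ y ∂n, |q y| ≤ K)
    (hmin : ∀ t : ℝ, 0 < t → t ≤ 1 →
      ∫ y, (p y - (φ y + η * (1 - ∫ x, Real.exp
          (φ y - Real.log (∫ y, Real.exp (φ y - a x y) ∂n) - a x y) ∂m))) ^ 2 ∂n ≤
        ∫ y, (p y + t * (q y - p y) - (φ y + η * (1 - ∫ x, Real.exp
          (φ y - Real.log (∫ y, Real.exp (φ y - a x y) ∂n) - a x y) ∂m))) ^ 2 ∂n) :
    (1 / (2 * η)) * (∫ y, (p y - φ y) ^ 2 ∂n) + (1 / η) * ∫ y, (p y - φ y) * (φ y - q y) ∂n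
      ≤ ((∫ y, p y ∂n) - ∫ x, Real.log (∫ y, Real.exp (p y - a x y) ∂n) ∂m)
        - ((∫ y, q y ∂n) - ∫ x, Real.log (∫ y, Real.exp (q y - a x y) ∂n) ∂m) := by
  have hsm := integral_log_integral_exp_sub_le_add ha ha0 hai hK hφ hφK hp hpK
  have hcv := add_le_integral_log_integral_exp_sub ha ha0 hai hK hφ hφK hq hqK
  have hPm := measurable_gibbs_marginal (m := m) (n := n) ha hφ
  have hPb := abs_gibbs_marginal_le ha ha0 hai hφ hφK
  set P := fun y => ∫ x, Real.exp
    (φ y - Real.log (∫ y, Real.exp (φ y - a x y) ∂n) - a x y) ∂m with hP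
  set L := ∫ x, Real.exp (2 * K) * ∫ y, Real.exp (a x y) ∂n ∂m with hL
  have hL0 : 0 ≤ L := integral_nonneg fun x =>
    mul_nonneg (Real.exp_pos _).le (integral_nonneg fun _ => (Real.exp_pos _).le)
  set S := Real.exp (2 * K) * ∫ z : X × Y, Real.exp (a z.1 z.2) ∂(m.prod n) with hS
  have hSη : S ≤ η⁻¹ := by
    have hS0 : 0 < S := inv_pos.1 (hη.trans_le hηle)
    exact (le_inv_comm₀ hη hS0).1 hηle
  set C := K + η * (1 + L) with hC
  have hKC : K ≤ C := by rw [hC]; nlinarith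
  have hvi : 0 ≤ ∫ y, (p y - (φ y + η * (1 - P y))) * (q y - p y) ∂n := by
    refine integral_mul_nonneg_of_projection (C := C) (by fun_prop) ?_ hp
      (hpK.mono fun y h => h.trans hKC) hq (hqK.mono fun y h => h.trans hKC) hmin
    filter_upwards [hφK, hPb] with y h1 h2
    refine (abs_add_le _ _).trans (add_le_add h1 ?_)
    rw [abs_mul, abs_of_pos hη]
    refine mul_le_mul_of_nonneg_left ?_ hη.le
    refine (abs_sub _ _).trans ?_
    rw [abs_one]
    gcongr
  have ip := integrable_of_measurable_of_ae_abs_le hp hpK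
  have iq := integrable_of_measurable_of_ae_abs_le hq hqK
  have iφ := integrable_of_measurable_of_ae_abs_le hφ hφK
  have iP := integrable_of_measurable_of_ae_abs_le hPm hPb
  have bd : ∀ {u v : Y → ℝ}, Integrable v n → Measurable u → (∀ᵐ y ∂n, |u y| ≤ K) →
      Integrable (fun y => u y * v y) n := fun hv hu huK =>
    hv.bdd_mul hu.aestronglyMeasurable huK
  have ipP := bd iP hp hpK
  have iqP := bd iP hq hqK
  have iφP := bd iP hφ hφK
  have ipp := bd ip hp hpK
  have ipφ := bd iφ hp hpK
  have ipq := bd iq hp hpK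
  have iφφ := bd iφ hφ hφK
  have iφq := bd iq hφ hφK
  have E1 : ∫ y, (p y - φ y) * P y ∂n = (∫ y, p y * P y ∂n) - ∫ y, φ y * P y ∂n := by
    rw [← integral_sub ipP iφP]; simp only [sub_mul]
  have E2 : ∫ y, (q y - φ y) * P y ∂n = (∫ y, q y * P y ∂n) - ∫ y, φ y * P y ∂n := by
    rw [← integral_sub iqP iφP]; simp only [sub_mul]
  have hA : Integrable (fun y => (p y - φ y) ^ 2) n := by
    have e : (fun y => (p y - φ y) ^ 2) =
        fun y => p y * p y - 2 * (p y * φ y) + φ y * φ y := by funext y; ring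
    rw [e]
    exact (ipp.sub (ipφ.const_mul 2)).add iφφ
  have hBi : Integrable (fun y => (p y - φ y) * (φ y - q y)) n := by
    have e : (fun y => (p y - φ y) * (φ y - q y)) =
        fun y => p y * φ y - p y * q y - φ y * φ y + φ y * q y := by funext y; ring
    rw [e]
    exact ((ipφ.sub ipq).sub iφφ).add iφq
  have E3 : ∫ y, (p y - (φ y + η * (1 - P y))) * (q y - p y) ∂n
      = η * ((∫ y, p y ∂n) - (∫ y, q y ∂n) - ((∫ y, p y * P y ∂n) - ∫ y, q y * P y ∂n))
        - (∫ y, (p y - φ y) ^ 2 ∂n) - ∫ y, (p y - φ y) * (φ y - q y) ∂n := by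
    have i1 : Integrable (fun y => p y - q y) n := ip.sub iq
    have i2 : Integrable (fun y => p y * P y - q y * P y) n := ipP.sub iqP
    have i3 : Integrable (fun y => η * (p y - q y - (p y * P y - q y * P y))) n :=
      (i1.sub i2).const_mul η
    have i4 : Integrable
        (fun y => η * (p y - q y - (p y * P y - q y * P y)) - (p y - φ y) ^ 2) n := i3.sub hA
    rw [← integral_sub ip iq, ← integral_sub ipP iqP, ← integral_sub i1 i2,
      ← integral_const_mul, ← integral_sub i3 hA, ← integral_sub i4 hBi]
    congr 1
    funext y
    ring
  rw [E1] at hsm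
  rw [E2] at hcv
  rw [E3] at hvi
  have hN : 0 ≤ ∫ y, (p y - φ y) ^ 2 ∂n := integral_nonneg fun _ => sq_nonneg _
  set N := ∫ y, (p y - φ y) ^ 2 ∂n
  set R := ∫ y, (p y - φ y) * (φ y - q y) ∂n
  set D := (∫ y, p y ∂n) - (∫ y, q y ∂n) - ((∫ y, p y * P y ∂n) - ∫ y, q y * P y ∂n)
    with hD
  have hD' : (1 / η) * (N + R) ≤ D := by
    rw [one_div, inv_mul_le_iff₀ hη]
    linarith
  have hSN : S * N ≤ η⁻¹ * N := mul_le_mul_of_nonneg_right hSη hN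
  have e : 1 / (2 * η) * N = (1 / η) * N - η⁻¹ * N / 2 := by field_simp; ring
  rw [e]
  linarith

end SemiDual

section Density

variable {E F : Type*} [MeasurableSpace E] [MeasurableSpace F] {κ : Measure E} {κ' : Measure F}

lemma integral_withDensity_ofReal {f g : E → ℝ} (hf : Measurable f) (hf0 : ∀ x, 0 ≤ f x) :
    ∫ x, g x ∂(κ.withDensity fun x => ENNReal.ofReal (f x)) = ∫ x, g x * f x ∂κ := by
  rw [integral_withDensity_eq_integral_toReal_smul hf.ennreal_ofReal (by simp)]
  simp only [ENNReal.toReal_ofReal (hf0 _), smul_eq_mul, mul_comm]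

lemma isProbabilityMeasure_withDensity_ofReal {f : E → ℝ} (hf0 : ∀ x, 0 ≤ f x)
    (hf1 : ∫ x, f x ∂κ = 1) :
    IsProbabilityMeasure (κ.withDensity fun x => ENNReal.ofReal (f x)) := by
  have hfi : Integrable f κ := by
    by_contra h
    rw [integral_undef h] at hf1
    exact zero_ne_one hf1
  refine ⟨?_⟩
  rw [withDensity_apply _ MeasurableSet.univ, Measure.restrict_univ,
    ← ofReal_integral_eq_lintegral_ofReal hfi (.of_forall hf0), hf1, ENNReal.ofReal_one]

lemma prod_withDensity_ofReal [SFinite κ] [SFinite κ'] {f : E → ℝ} {g : F → ℝ}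
    (hf : Measurable f) (hg : Measurable g) (hf0 : ∀ x, 0 ≤ f x) :
    (κ.withDensity fun x => ENNReal.ofReal (f x)).prod
        (κ'.withDensity fun y => ENNReal.ofReal (g y))
      = (κ.prod κ').withDensity fun z => ENNReal.ofReal (f z.1 * g z.2) := by
  rw [prod_withDensity hf.ennreal_ofReal hg.ennreal_ofReal]
  simp only [ENNReal.ofReal_mul (hf0 _)]

end Density

/-- Fundamental inequality for the projected step.
For `φ ∈ S_B̄`, `η ≤ λ(max{B,B̄})⁻¹` and every `φ̄ ∈ S_B`,
`J(M(φ;η)) − J(φ̄) ≥ (1/(2η))‖M(φ;η) − φ‖²_{L²(ν)} + (1/η)⟨M(φ;η) − φ, φ − φ̄⟩_{L²(ν)}`. -/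
theorem projSGA_fundamental_inequality
    (μ ν : (Fin d → ℝ) → ℝ) (c : (Fin d → ℝ) → (Fin d → ℝ) → ℝ) (ε : ℝ)
    (hε : 0 < ε) (hμ0 : ∀ x, 0 ≤ μ x) (hν0 : ∀ y, 0 ≤ ν y)
    (hμm : Measurable μ) (hνm : Measurable ν)
    (hμ1 : (∫ x, μ x) = 1) (hν1 : (∫ y, ν y) = 1)
    (hc : Measurable (Function.uncurry c))
    (hc0 : ∀ x y, 0 ≤ c x y)
    (B Bb : ℝ) (hB : 0 < B) (hBb : 0 < Bb)
    (hlamfin : Integrable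
      (fun z : (Fin d → ℝ) × (Fin d → ℝ) => Real.exp (c z.1 z.2 / ε) * μ z.1 * ν z.2))
    (SB : Set ((Fin d → ℝ) → ℝ))
    (hSB : SB = {ψ | Measurable ψ ∧ ∀ᵐ y ∂(volume : Measure (Fin d → ℝ)), |ψ y| ≤ B})
    (φ : (Fin d → ℝ) → ℝ) (hφm : Measurable φ)
    (hφBb : ∀ᵐ y ∂(volume : Measure (Fin d → ℝ)), |φ y| ≤ Bb)
    (M : ((Fin d → ℝ) → ℝ) → ℝ → ((Fin d → ℝ) → ℝ))
    (hM : ∀ η : ℝ, 0 < η → M φ η ∈ SB ∧ ∀ χ ∈ SB,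
      (∫ y, (M φ η y - (φ y + η * (deltaJ μ ν c ε φ y / ν y))) ^ 2 * ν y) ≤
        ∫ y, (χ y - (φ y + η * (deltaJ μ ν c ε φ y / ν y))) ^ 2 * ν y)
    (η : ℝ) (hη : 0 < η) (hηle : η ≤ (lamB μ ν c ε (max B Bb))⁻¹) :
    ∀ φb ∈ SB,
      semiDual μ ν c ε (M φ η) - semiDual μ ν c ε φb ≥
        (1 / (2 * η)) * (∫ y, (M φ η y - φ y) ^ 2 * ν y) +
          (1 / η) * ∫ y, (M φ η y - φ y) * (φ y - φb y) * ν y := by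
  subst hSB
  intro φb hφb
  set K := max B Bb with hKdef
  set a : (Fin d → ℝ) → (Fin d → ℝ) → ℝ := fun x y => c x y / ε with hadef
  set m := (volume : Measure (Fin d → ℝ)).withDensity fun x => ENNReal.ofReal (μ x) with hm
  set n := (volume : Measure (Fin d → ℝ)).withDensity fun y => ENNReal.ofReal (ν y) with hn
  have hmP : IsProbabilityMeasure m := isProbabilityMeasure_withDensity_ofReal hμ0 hμ1
  have hnP : IsProbabilityMeasure n := isProbabilityMeasure_withDensity_ofReal hν0 hν1
  have hac : n ≪ volume := withDensity_absolutelyContinuous _ _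
  have Im : ∀ g : (Fin d → ℝ) → ℝ, ∫ x, g x * μ x = ∫ x, g x ∂m := fun g =>
    (integral_withDensity_ofReal hμm hμ0).symm
  have In : ∀ g : (Fin d → ℝ) → ℝ, ∫ y, g y * ν y = ∫ y, g y ∂n := fun g =>
    (integral_withDensity_ofReal hνm hν0).symm
  have hprod : m.prod n = volume.withDensity fun z : (Fin d → ℝ) × (Fin d → ℝ) =>
      ENNReal.ofReal (μ z.1 * ν z.2) := prod_withDensity_ofReal hμm hνm hμ0
  have hdm : Measurable fun z : (Fin d → ℝ) × (Fin d → ℝ) => μ z.1 * ν z.2 := by fun_prop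
  have hd0 : ∀ z : (Fin d → ℝ) × (Fin d → ℝ), 0 ≤ μ z.1 * ν z.2 := fun z =>
    mul_nonneg (hμ0 _) (hν0 _)
  have ha : Measurable (Function.uncurry a) := hc.div_const ε
  have ha0 : ∀ x y, 0 ≤ a x y := fun x y => div_nonneg (hc0 x y) hε.le
  have hai : Integrable (fun z : (Fin d → ℝ) × (Fin d → ℝ) => Real.exp (a z.1 z.2))
      (m.prod n) := by
    rw [hprod, integrable_withDensity_iff hdm.ennreal_ofReal (by simp)]
    simpa only [ENNReal.toReal_ofReal (hd0 _), ← mul_assoc] using hlamfin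
  have hlam : lamB μ ν c ε K = Real.exp (2 * K) *
      ∫ z : (Fin d → ℝ) × (Fin d → ℝ), Real.exp (a z.1 z.2) ∂(m.prod n) := by
    rw [hprod, integral_withDensity_ofReal hdm hd0]
    simp only [lamB, hadef, mul_assoc]
  have hphi : ∀ ψ x, phiPlus ν c ε ψ x = Real.log (∫ y, Real.exp (ψ y - a x y) ∂n) :=
    fun ψ x => by rw [phiPlus, In]
  have hJ : ∀ ψ, semiDual μ ν c ε ψ
      = (∫ y, ψ y ∂n) - ∫ x, Real.log (∫ y, Real.exp (ψ y - a x y) ∂n) ∂m := fun ψ => by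
    rw [semiDual, In, Im]
    simp only [hphi]
  have hpiY : ∀ y, piY μ ν c ε φ y = (∫ x, Real.exp
      (φ y - Real.log (∫ y, Real.exp (φ y - a x y) ∂n) - a x y) ∂m) * ν y := fun y => by
    rw [← Im, ← integral_mul_const]
    simp only [piY, piJoint, hphi, hadef]
  have hν_ne : ∀ᵐ y ∂n, ν y ≠ 0 := by
    rw [hn, ae_withDensity_iff hνm.ennreal_ofReal]
    exact .of_forall fun y hy h0 => hy (by simp [h0])
  have hgrad : ∀ᵐ y ∂n, deltaJ μ ν c ε φ y / ν y = 1 - ∫ x, Real.exp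
      (φ y - Real.log (∫ y, Real.exp (φ y - a x y) ∂n) - a x y) ∂m := by
    filter_upwards [hν_ne] with y hy
    rw [deltaJ, hpiY]
    field_simp
  have hobj : ∀ χ : (Fin d → ℝ) → ℝ,
      ∫ y, (χ y - (φ y + η * (deltaJ μ ν c ε φ y / ν y))) ^ 2 * ν y
        = ∫ y, (χ y - (φ y + η * (1 - ∫ x, Real.exp
          (φ y - Real.log (∫ y, Real.exp (φ y - a x y) ∂n) - a x y) ∂m))) ^ 2 ∂n := fun χ => by
    rw [In]
    refine integral_congr_ae ?_
    filter_upwards [hgrad] with y hy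
    rw [hy]
  obtain ⟨⟨hpm, hpB⟩, hmin⟩ := hM η hη
  have hBK : B ≤ K := le_max_left _ _
  rw [hlam] at hηle
  rw [hJ, hJ, In, In, ge_iff_le]
  refine semidual_projected_step ha ha0 hai (hB.le.trans hBK) hη hηle hφm
    (hac.ae_le (hφBb.mono fun y h => h.trans (le_max_right _ _)))
    hpm (hac.ae_le (hpB.mono fun y h => h.trans hBK))
    hφb.1 (hac.ae_le (hφb.2.mono fun y h => h.trans hBK)) fun t ht ht1 => ?_
  have h := hmin (fun y => M φ η y + t * (φb y - M φ η y))
    ⟨hpm.add ((hφb.1.sub hpm).const_mul t), by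
      filter_upwards [hpB, hφb.2] with y h1 h2
      rw [abs_le] at h1 h2 ⊢
      constructor <;> nlinarith⟩
  rwa [hobj, hobj] at h
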